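/- arXiv:1704.04509 — 4 statements merged into one kernel-verified Lean document; each statement's English description precedes it below -/
import Mathlib

section
/- Let 𝒜 ⊆ binom(X, k) be a nonempty family of k-subsets of a finite set X, and let ℓ_k(|𝒜|) be the unique nonnegative real number with |𝒜| = C(k−1+ℓ_k(|𝒜|), k). Then |Δ𝒜| ≥ |𝒜|·k/ℓ_k(|𝒜|). -/
/-- Generalized binomial coefficient `C(x, k)` for real `x`. -/
noncomputable def rchoose (x : ℝ) (k : ℕ) : ℝ :=
  (∏ i ∈ Finset.range k, (x - i)) / (k.factorial : ℝ)

open Finset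

theorem rchoose_zero (x : ℝ) : rchoose x 0 = 1 := by simp [rchoose]

theorem rchoose_succ (x : ℝ) (k : ℕ) :
    rchoose x (k + 1) * (k + 1) = rchoose x k * (x - k) := by
  have := Nat.factorial_ne_zero k
  simp only [rchoose, prod_range_succ, Nat.factorial_succ]
  push_cast
  field_simp

theorem rchoose_succ' (x : ℝ) (k : ℕ) :
    rchoose x (k + 1) * (k + 1) = rchoose (x - 1) k * x := by
  have := Nat.factorial_ne_zero k
  have h : ∏ i ∈ range k, (x - ((i + 1 : ℕ) : ℝ)) = ∏ i ∈ range k, (x - 1 - i) :=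
    prod_congr rfl fun i _ => by push_cast; ring
  simp only [rchoose, prod_range_succ', Nat.factorial_succ, h]
  push_cast
  field_simp
  simp [mul_comm]

theorem continuous_rchoose (k : ℕ) : Continuous fun x => rchoose x k := by
  unfold rchoose
  fun_prop

theorem rchoose_self (k : ℕ) : rchoose k k = 1 := by
  induction k with
  | zero => exact rchoose_zero _
  | succ k ih =>
    have h := rchoose_succ' ((k + 1 : ℕ) : ℝ) k
    have hk : (0 : ℝ) < k + 1 := by positivity
    push_cast at h ⊢
    rw [add_sub_cancel_right, ih] at h
    exact mul_right_cancel₀ hk.ne' h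

theorem rchoose_lt_rchoose {x y : ℝ} {k : ℕ} (hk : 0 < k) (hx : (k : ℝ) - 1 ≤ x) (hxy : x < y) :
    rchoose x k < rchoose y k := by
  have aux : ∀ i ∈ range k, (i : ℝ) + 1 ≤ k := fun i hi => by exact_mod_cast mem_range.1 hi
  unfold rchoose
  gcongr
  by_cases h0 : ∏ i ∈ range k, (x - i) = 0
  · rw [h0]
    exact prod_pos fun i hi => by linarith [aux i hi]
  · refine prod_lt_prod_of_nonempty (fun i hi => ?_) (fun i _ => by linarith) ⟨0, mem_range.2 hk⟩
    exact lt_of_le_of_ne (by linarith [aux i hi]) (Ne.symm (prod_ne_zero_iff.1 h0 i hi))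

theorem exists_rchoose_eq {x c : ℝ} {k : ℕ} (hx : (k : ℝ) ≤ x) (hc : 1 ≤ c)
    (hcx : c ≤ rchoose x k) : ∃ y, (k : ℝ) ≤ y ∧ y ≤ x ∧ rchoose y k = c := by
  obtain ⟨y, hy, h⟩ := intermediate_value_Icc hx (continuous_rchoose k).continuousOn
    ⟨(rchoose_self k).trans_le hc, hcx⟩
  exact ⟨y, hy.1, hy.2, h⟩

section Link

variable {X : Type*} [DecidableEq X]

theorem card_memberSubfamily (v : X) (𝒜 : Finset (Finset X)) :
    #(𝒜.memberSubfamily v) = #{s ∈ 𝒜 | v ∈ s} := by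
  have h₁ := card_memberSubfamily_add_card_nonMemberSubfamily v 𝒜
  have h₂ := card_filter_add_card_filter_not (s := 𝒜) (fun s => v ∈ s)
  simp only [nonMemberSubfamily] at h₁
  omega

theorem sum_card_memberSubfamily [Fintype X] {𝒜 : Finset (Finset X)} {r : ℕ}
    (h𝒜 : ∀ s ∈ 𝒜, #s = r) : ∑ v, #(𝒜.memberSubfamily v) = #𝒜 * r := by
  simp only [card_memberSubfamily]
  rw [← sum_const_nat h𝒜]
  simp only [card_filter]
  rw [sum_comm]
  exact sum_congr rfl fun s _ => by simp

theorem card_of_mem_memberSubfamily {𝒜 : Finset (Finset X)} {r : ℕ}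
    (h𝒜 : ∀ s ∈ 𝒜, #s = r + 1) (v : X) : ∀ s ∈ 𝒜.memberSubfamily v, #s = r := by
  intro s hs
  obtain ⟨h, hv⟩ := mem_memberSubfamily.1 hs
  have := h𝒜 _ h
  rw [card_insert_of_notMem hv] at this
  omega

theorem shadow_memberSubfamily_subset (v : X) (𝒜 : Finset (Finset X)) :
    (𝒜.memberSubfamily v).shadow ⊆ 𝒜.shadow.memberSubfamily v := by
  intro t ht
  obtain ⟨s, hs, a, ha, rfl⟩ := mem_shadow_iff.1 ht
  obtain ⟨h, hv⟩ := mem_memberSubfamily.1 hs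
  have hav : v ≠ a := fun e => hv (e ▸ ha)
  refine mem_memberSubfamily.2 ⟨?_, fun h' => hv (mem_of_mem_erase h')⟩
  rw [← erase_insert_of_ne hav]
  exact erase_mem_shadow h (mem_insert_of_mem ha)

theorem memberSubfamily_subset_nonMemberSubfamily_shadow (v : X) (𝒜 : Finset (Finset X)) :
    𝒜.memberSubfamily v ⊆ 𝒜.shadow.nonMemberSubfamily v := by
  intro s hs
  obtain ⟨h, hv⟩ := mem_memberSubfamily.1 hs
  refine mem_nonMemberSubfamily.2 ⟨?_, hv⟩
  simpa [hv] using erase_mem_shadow h (mem_insert_self v s)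

/-- **Lovász's form of the Kruskal–Katona theorem**, for real parameters (Keevash's proof). -/
theorem card_le_rchoose_of_card_shadow_le [Fintype X] {r : ℕ} (hr : 0 < r)
    {𝒜 : Finset (Finset X)} (h𝒜 : ∀ s ∈ 𝒜, #s = r + 1) {y : ℝ} (hy : (r : ℝ) ≤ y)
    (hcard : (#𝒜.shadow : ℝ) ≤ rchoose y r) : (#𝒜 : ℝ) ≤ rchoose y (r + 1) := by
  induction r generalizing 𝒜 y with
  | zero => exact absurd hr (lt_irrefl 0)
  | succ r ih =>
    push_cast at hy
    have hr0 : (0 : ℝ) ≤ r := r.cast_nonneg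
    have hshadow : ∀ s ∈ 𝒜.shadow, #s = r + 1 := fun s hs => by
      obtain ⟨t, ht, a, ha, rfl⟩ := mem_shadow_iff.1 hs
      rw [card_erase_of_mem ha, h𝒜 t ht]
      rfl
    have key (v : X) : (#(𝒜.memberSubfamily v) : ℝ) * (r + 1) ≤
        (y - (r + 1)) * #(𝒜.shadow.memberSubfamily v) := by
      have hsub : (#(𝒜.memberSubfamily v).shadow : ℝ) ≤ #(𝒜.shadow.memberSubfamily v) :=
        mod_cast card_le_card (shadow_memberSubfamily_subset v 𝒜)
      have hadd : (#(𝒜.memberSubfamily v) : ℝ) + #(𝒜.shadow.memberSubfamily v) ≤ #𝒜.shadow := by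
        have h₁ := card_le_card (memberSubfamily_subset_nonMemberSubfamily_shadow v 𝒜)
        have h₂ := card_memberSubfamily_add_card_nonMemberSubfamily v 𝒜.shadow
        exact_mod_cast (by omega :
          #(𝒜.memberSubfamily v) + #(𝒜.shadow.memberSubfamily v) ≤ #𝒜.shadow)
      have hrec := rchoose_succ' y r
      rcases le_or_gt (rchoose (y - 1) r) #(𝒜.shadow.memberSubfamily v) with hd | hd
      · have := mul_le_mul_of_nonneg_right hd (by linarith : (0 : ℝ) ≤ y)
        nlinarith
      · have hlink := card_of_mem_memberSubfamily h𝒜 v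
        rcases Nat.eq_zero_or_pos #(𝒜.shadow.memberSubfamily v) with h0 | hpos
        · have hempty : 𝒜.memberSubfamily v = ∅ := by
            refine eq_empty_of_forall_notMem fun s hs => ?_
            obtain ⟨a, ha⟩ := card_pos.1 (r.succ_pos.trans_eq (hlink s hs).symm)
            exact (card_pos.2 ⟨_, shadow_memberSubfamily_subset v 𝒜
              (erase_mem_shadow hs ha)⟩).ne' h0
          simp [hempty, h0]
        · have hd1 : (1 : ℝ) ≤ #(𝒜.shadow.memberSubfamily v) := mod_cast hpos
          have hr : 0 < r := by
            refine Nat.pos_of_ne_zero fun e => ?_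
            rw [e, rchoose_zero] at hd
            linarith
          obtain ⟨z, hrz, hzy, hz⟩ := exists_rchoose_eq (x := y - 1) (by linarith) hd1 hd.le
          have hle := ih hr hlink hrz (hz ▸ hsub)
          have hrecz := rchoose_succ z r
          rw [hz] at hrecz
          nlinarith
    have hsum := sum_le_sum fun v (_ : v ∈ univ) => key v
    rw [← sum_mul, ← mul_sum, ← Nat.cast_sum, ← Nat.cast_sum, sum_card_memberSubfamily h𝒜,
      sum_card_memberSubfamily hshadow] at hsum
    have hrec := rchoose_succ y (r + 1)
    push_cast at hsum hrec
    have h₁ : (#𝒜 : ℝ) * (r + 1 + 1) ≤ (y - (r + 1)) * #𝒜.shadow := by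
      refine le_of_mul_le_mul_right (a := (r : ℝ) + 1) ?_ (by positivity)
      linarith
    have h₂ := mul_le_mul_of_nonneg_left hcard (by linarith : (0 : ℝ) ≤ y - (r + 1))
    refine le_of_mul_le_mul_right (a := (r : ℝ) + 1 + 1) ?_ (by positivity)
    linarith

end Link

theorem shadow_ratio_lower_bound {X : Type*} [DecidableEq X] [Fintype X]
    (k : ℕ) (hk : 0 < k) (𝒜 : Finset (Finset X)) (hne : 𝒜.Nonempty)
    (h𝒜 : ∀ A ∈ 𝒜, A.card = k)
    (ℓ : ℝ) (hℓ0 : 0 ≤ ℓ) (hℓ : (𝒜.card : ℝ) = rchoose ((k : ℝ) - 1 + ℓ) k) :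
    (𝒜.card : ℝ) * k / ℓ ≤ ((Finset.shadow 𝒜).card : ℝ) := by
  have hcard : (1 : ℝ) ≤ #𝒜 := mod_cast hne.card_pos
  have hℓ1 : 1 ≤ ℓ := by
    by_contra! h
    have := rchoose_lt_rchoose (x := k - 1 + ℓ) (y := k) hk (by linarith) (by linarith)
    rw [rchoose_self] at this
    linarith
  have hshadow : (1 : ℝ) ≤ #𝒜.shadow := by
    obtain ⟨s, hs⟩ := hne
    obtain ⟨a, ha⟩ := card_pos.1 ((h𝒜 s hs).symm ▸ hk)
    exact_mod_cast card_pos.2 ⟨_, erase_mem_shadow hs ha⟩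
  obtain ⟨r, rfl⟩ : ∃ r, k = r + 1 := ⟨k - 1, by omega⟩
  push_cast at hℓ ⊢
  rw [add_sub_cancel_right] at hℓ
  have hrec := rchoose_succ (r + ℓ) r
  rw [← hℓ, add_sub_cancel_left] at hrec
  rw [hrec, mul_div_cancel_right₀ _ (by positivity)]
  by_contra! hlt
  rcases Nat.eq_zero_or_pos r with rfl | hr
  · rw [rchoose_zero] at hlt
    linarith
  obtain ⟨y, hry, hyx, hy⟩ := exists_rchoose_eq (x := r + ℓ) (by linarith) hshadow hlt.le
  have hyx' : y < r + ℓ := lt_of_le_of_ne hyx fun e => by rw [e] at hy; exact hlt.ne' hy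
  have h₁ := card_le_rchoose_of_card_shadow_le hr h𝒜 hry hy.ge
  have h₂ := rchoose_lt_rchoose (k := r + 1) hk (by push_cast; linarith) hyx'
  linarith
end

section
/- Let 𝒟 be a probability distribution on the symmetric group S_n whose transition graph equals that of the uniform distribution on S_n (i.e., for every k and every k-subset S of [n], Pr_{π∼𝒟}[π([k]) = S] = 1/C(n,k), and conditional on π([k]) = S each element of S is equally likely to be π(k)). Then 𝒟 is exact minwise: for every nonempty Y ⊆ [n] and every x ∈ Y, Pr_{π∼𝒟}[π⁻¹ applied: x attains min π(Y)] = 1/|Y|. -/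
open Finset in
/-- The set of elements that `π` lists no later than `x`. -/
def initialSegment {n : ℕ} (π : Equiv.Perm (Fin n)) (x : Fin n) : Finset (Fin n) :=
  univ.filter fun z => π.symm z ≤ π.symm x

theorem mem_initialSegment {n : ℕ} {π : Equiv.Perm (Fin n)} {x z : Fin n} :
    z ∈ initialSegment π x ↔ π.symm z ≤ π.symm x := by
  simp [initialSegment]

theorem card_initialSegment {n : ℕ} (π : Equiv.Perm (Fin n)) (x : Fin n) :
    (initialSegment π x).card = (π.symm x : ℕ) + 1 := by
  have h : initialSegment π x = (Finset.Iic (π.symm x)).map π.toEmbedding := by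
    ext z
    simp [mem_initialSegment, Finset.mem_map_equiv]
  rw [h, Finset.card_map, Fin.card_Iic]

open Finset in
theorem image_initial_positions_eq_iff {n : ℕ} (k : ℕ) (π : Equiv.Perm (Fin n))
    (S : Finset (Fin n)) :
    (univ.filter (fun i : Fin n => (i : ℕ) < k)).image π = S ↔
      ∀ z, z ∈ S ↔ (π.symm z : ℕ) < k := by
  have h : ∀ z, z ∈ (univ.filter (fun i : Fin n => (i : ℕ) < k)).image π ↔
      (π.symm z : ℕ) < k := by
    intro z
    simp only [mem_image, mem_filter, mem_univ, true_and]
    constructor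
    · rintro ⟨i, hi, rfl⟩
      simpa using hi
    · intro hz
      exact ⟨π.symm z, hz, by simp⟩
  rw [Finset.ext_iff]
  exact forall_congr' fun z => by rw [h z]; exact iff_comm

/-- If `S` meets `Y` only in `x`, then `S` fills the first `S.card` positions of `π` with `x` in the
last of them exactly when `x` comes first among `Y` and `S` is the initial segment of `π` at `x`. -/
theorem image_eq_and_apply_eq_iff {n : ℕ} {π : Equiv.Perm (Fin n)} {S Y : Finset (Fin n)}
    {x : Fin n} (hS : S ∩ Y = {x}) (h : S.card - 1 < n) :
    ((Finset.univ.filter (fun i : Fin n => (i : ℕ) < S.card)).image π = S ∧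
        π ⟨S.card - 1, h⟩ = x) ↔
      (∀ y ∈ Y, π.symm x ≤ π.symm y) ∧ initialSegment π x = S := by
  rw [image_initial_positions_eq_iff]
  have hxS : x ∈ S := (Finset.mem_inter.1 (hS ▸ Finset.mem_singleton_self x)).1
  have hpos : 0 < S.card := Finset.card_pos.2 ⟨x, hxS⟩
  constructor
  · rintro ⟨hmem, hx⟩
    have hx' : (π.symm x : ℕ) = S.card - 1 := by
      rw [← hx]
      simp
    refine ⟨fun y hy => ?_, ?_⟩
    · by_contra! hlt
      have hyS : y ∈ S := (hmem y).2 (by have := Fin.lt_def.1 hlt; omega)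
      have hyx : y = x := Finset.mem_singleton.1 (hS ▸ Finset.mem_inter.2 ⟨hyS, hy⟩)
      exact hlt.ne (by rw [hyx])
    · ext z
      rw [mem_initialSegment, hmem z, Fin.le_def]
      omega
  · rintro ⟨-, hseg⟩
    have hcard : S.card = (π.symm x : ℕ) + 1 := by rw [← hseg, card_initialSegment]
    refine ⟨fun z => ?_, ?_⟩
    · rw [hcard, ← hseg, mem_initialSegment, Fin.le_def]
      omega
    · rw [← Equiv.eq_symm_apply]
      ext
      simp [hcard]

theorem initialSegment_inter_eq_singleton {n : ℕ} {π : Equiv.Perm (Fin n)} {Y : Finset (Fin n)}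
    {x : Fin n} (hx : x ∈ Y) (hmin : ∀ y ∈ Y, π.symm x ≤ π.symm y) :
    initialSegment π x ∩ Y = {x} := by
  ext z
  rw [Finset.mem_inter, mem_initialSegment, Finset.mem_singleton]
  constructor
  · rintro ⟨hz, hzY⟩
    exact π.symm.injective (le_antisymm hz (hmin z hzY))
  · rintro rfl
    exact ⟨le_rfl, hx⟩

open Finset in
/-- A sum of a function of the cardinality over the sets meeting `Y` only in `x` does not depend
on `x ∈ Y`. -/
theorem sum_card_filter_inter_eq_singleton {α M : Type*} [Fintype α] [DecidableEq α]
    [AddCommMonoid M] (f : ℕ → M) {Y : Finset α} {x y : α} (hx : x ∈ Y) (hy : y ∈ Y) :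
    ∑ S ∈ univ.filter (fun S : Finset α => S ∩ Y = {x}), f S.card =
      ∑ S ∈ univ.filter (fun S : Finset α => S ∩ Y = {y}), f S.card := by
  have hY : Y.map (Equiv.swap x y).toEmbedding = Y := by
    ext z
    rw [mem_map_equiv, Equiv.symm_swap, Equiv.swap_apply_def]
    split_ifs <;> simp_all
  refine sum_equiv (Equiv.swap x y).finsetCongr (fun S => ?_) (fun S _ => by simp)
  simp only [mem_filter, mem_univ, true_and, Equiv.finsetCongr_apply]
  conv_rhs => rw [← hY, ← map_inter]
  have hsing : ({y} : Finset α) = ({x} : Finset α).map (Equiv.swap x y).toEmbedding := by simp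
  rw [hsing, map_inj]

open Finset in
theorem sum_sum_filter_symm_min {n : ℕ} {M : Type*} [AddCommMonoid M]
    (D : Equiv.Perm (Fin n) → M) {Y : Finset (Fin n)} (hY : Y.Nonempty) :
    ∑ x ∈ Y, ∑ π ∈ univ.filter (fun π : Equiv.Perm (Fin n) =>
      ∀ y ∈ Y, π.symm x ≤ π.symm y), D π = ∑ π, D π := by
  simp_rw [sum_filter]
  rw [sum_comm]
  refine sum_congr rfl fun π _ => ?_
  obtain ⟨x, hx, hmin⟩ := Y.exists_min_image π.symm hY
  rw [sum_eq_single_of_mem x hx, if_pos hmin]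
  intro z hz hzx
  exact if_neg fun h => hzx (π.symm.injective (le_antisymm (h x hx) (hmin z hz)))


open Finset in
theorem uniform_transition_graph_implies_minwise (n : ℕ)
    (D : Equiv.Perm (Fin n) → ℝ)
    (hD0 : ∀ π, 0 ≤ D π)
    (hD1 : ∑ π : Equiv.Perm (Fin n), D π = 1)
    -- for every k and every k-subset S of [n], Pr[π([k]) = S] = 1 / C(n,k)
    (huni : ∀ k : ℕ, k ≤ n → ∀ S : Finset (Fin n), S.card = k →
      ∑ π ∈ univ.filter (fun π : Equiv.Perm (Fin n) =>
          (univ.filter (fun i : Fin n => (i : ℕ) < k)).image π = S), D π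
        = 1 / (n.choose k : ℝ))
    -- conditional on π([k]) = S, each element of S is equally likely to be π(k)
    (hcond : ∀ k : ℕ, ∀ _hk1 : 1 ≤ k, ∀ _hk2 : k ≤ n,
      ∀ S : Finset (Fin n), S.card = k → ∀ x ∈ S,
      ∑ π ∈ univ.filter (fun π : Equiv.Perm (Fin n) =>
          (univ.filter (fun i : Fin n => (i : ℕ) < k)).image π = S ∧
          π ⟨k - 1, by omega⟩ = x), D π
        = (∑ π ∈ univ.filter (fun π : Equiv.Perm (Fin n) =>
            (univ.filter (fun i : Fin n => (i : ℕ) < k)).image π = S), D π) / (k : ℝ)) :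
    -- conclusion: D is exact minwise
    ∀ Y : Finset (Fin n), Y.Nonempty → ∀ x ∈ Y,
      ∑ π ∈ univ.filter (fun π : Equiv.Perm (Fin n) =>
          ∀ y ∈ Y, π.symm x ≤ π.symm y), D π = 1 / (Y.card : ℝ) := by
  intro Y hY x hx
  have hprob : ∀ z ∈ Y, ∑ π ∈ univ.filter (fun π : Equiv.Perm (Fin n) =>
      ∀ y ∈ Y, π.symm z ≤ π.symm y), D π =
        ∑ S ∈ univ.filter (fun S : Finset (Fin n) => S ∩ Y = {z}),
          1 / (n.choose S.card : ℝ) / (S.card : ℝ) := by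
    intro z hz
    rw [← sum_fiberwise_of_maps_to (g := fun π => initialSegment π z)
      (t := univ.filter fun S : Finset (Fin n) => S ∩ Y = {z})
      (fun π hπ => by simpa using initialSegment_inter_eq_singleton hz (mem_filter.1 hπ).2)]
    refine sum_congr rfl fun S hS => ?_
    have hS' : S ∩ Y = {z} := (mem_filter.1 hS).2
    have hzS : z ∈ S := (mem_inter.1 (hS' ▸ mem_singleton_self z)).1
    have hpos : 1 ≤ S.card := card_pos.2 ⟨z, hzS⟩
    have hle : S.card ≤ n := by simpa using S.card_le_univ
    rw [← huni S.card hle S rfl, ← hcond S.card hpos hle S rfl z hzS, filter_filter]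
    refine sum_congr (filter_congr fun π _ => ?_) fun _ _ => rfl
    exact (image_eq_and_apply_eq_iff hS' (by omega)).symm
  have htotal := sum_sum_filter_symm_min D hY
  rw [hD1, sum_congr rfl fun z hz => (hprob z hz).trans
    ((sum_card_filter_inter_eq_singleton (fun k => 1 / (n.choose k : ℝ) / (k : ℝ)) hz hx).trans
      (hprob x hx).symm), sum_const, nsmul_eq_mul] at htotal
  have hcard : (Y.card : ℝ) ≠ 0 := Nat.cast_ne_zero.2 (card_pos.2 hY).ne'
  rw [eq_div_iff hcard, mul_comm]
  exact htotal
end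

section
/- Let w : 𝒫(X) → [0,1] be a weight-function supported on the k-subsets of a finite set X with S(w) ≤ 1, and define (Δw)(B) = max_{a ∉ B} w(B ∪ {a}) for B ≠ X, (Δw)(X) = 0. Then for every nonnegative integer i, S(Δ π_i w) ≥ S(π_i w) · k/ℓ_k(2^i), where ℓ_k(x) is the unique nonnegative real with x = C(k−1+ℓ_k(x), k) and (π_i w)(A) = 2^{-(i+1)}·[w(A) ≥ 2^{-i}]. -/
open Finset in
/-- Double counting of incidences between points and members of a uniform family. -/
theorem sum_card_filter_mem_of_sized {X : Type*} [DecidableEq X] [Fintype X]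
    (F : Finset (Finset X)) (n : ℕ) (hF : ∀ A ∈ F, #A = n) :
    ∑ v : X, #{A ∈ F | v ∈ A} = n * #F := by
  have h := sum_card_bipartiteAbove_eq_sum_card_bipartiteBelow
    (s := (univ : Finset X)) (t := F) (fun v A => v ∈ A)
  simp only [bipartiteAbove, bipartiteBelow, filter_univ_mem] at h
  rw [h, sum_congr rfl hF, sum_const, smul_eq_mul, mul_comm]

open Finset in
theorem card_image_erase_filter_mem {X : Type*} [DecidableEq X]
    (F : Finset (Finset X)) (v : X) :
    #(({A ∈ F | v ∈ A}).image (fun A => A.erase v)) = #{A ∈ F | v ∈ A} := by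
  refine card_image_of_injOn fun A hA B hB h => ?_
  simp only [coe_filter, Set.mem_ofPred_eq] at hA hB
  rw [← insert_erase hA.2, ← insert_erase hB.2]
  exact congrArg (insert v) h

theorem rchoose_succ_succ (x : ℝ) (r : ℕ) :
    (r + 1) * rchoose (x + 1) (r + 1) = (x + 1) * rchoose x r := by
  have h : ∏ i ∈ Finset.range r, (x + 1 - ((i + 1 : ℕ) : ℝ)) = ∏ i ∈ Finset.range r, (x - i) :=
    Finset.prod_congr rfl fun i _ => by push_cast; ring
  have hr : (r.factorial : ℝ) ≠ 0 := by positivity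
  simp only [rchoose, Finset.prod_range_succ', h, Nat.factorial_succ]
  push_cast
  field_simp
  ring

theorem rchoose_succ_right (x : ℝ) (r : ℕ) :
    (r + 1) * rchoose x (r + 1) = (x - r) * rchoose x r := by
  have hr : (r.factorial : ℝ) ≠ 0 := by positivity
  simp only [rchoose, Finset.prod_range_succ, Nat.factorial_succ]
  push_cast
  field_simp

open Finset in
/-- Clique form of Lovász's version of the Kruskal–Katona theorem: if every set obtained by deleting
a point from a member of `F` lies in `G`, then `F` is small relative to `G`. -/
theorem card_le_of_erase_mem {X : Type*} [DecidableEq X] [Fintype X] {s : ℝ} (hs : 0 ≤ s)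
    (r : ℕ) (F G : Finset (Finset X)) (hF : ∀ A ∈ F, #A = r + 2) (hG : ∀ A ∈ G, #A = r + 1)
    (hFG : ∀ A ∈ F, ∀ a ∈ A, A.erase a ∈ G)
    (hcard : (#G : ℝ) ≤ rchoose (r + s + 1) (r + 1)) :
    (r + 2) * (#F : ℝ) ≤ s * #G := by
  induction r using Nat.strong_induction_on generalizing F G with
  | _ r ih =>
  suffices key : ∀ v : X, (r + 1) * (#{A ∈ F | v ∈ A} : ℝ) ≤ s * #{B ∈ G | v ∈ B} by
    have h := sum_le_sum fun v (_ : v ∈ (univ : Finset X)) => key v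
    rw [← mul_sum, ← mul_sum, ← Nat.cast_sum, ← Nat.cast_sum,
      sum_card_filter_mem_of_sized F _ hF, sum_card_filter_mem_of_sized G _ hG] at h
    push_cast at h
    have hr : (0 : ℝ) < r + 1 := by positivity
    refine le_of_mul_le_mul_left ?_ hr
    linarith
  intro v
  rcases le_or_gt (rchoose (r + s) r) (#{B ∈ G | v ∈ B} : ℝ) with hd | hd
  · have h₁ : #{A ∈ F | v ∈ A} ≤ #{B ∈ G | v ∉ B} := by
      rw [← card_image_erase_filter_mem]
      refine card_le_card fun B hB => ?_
      simp only [mem_image, mem_filter] at hB ⊢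
      obtain ⟨A, ⟨hA, hv⟩, rfl⟩ := hB
      exact ⟨hFG A hA v hv, notMem_erase v A⟩
    have h₂ : (#{B ∈ G | v ∈ B} : ℝ) + #{B ∈ G | v ∉ B} = #G := by
      exact_mod_cast card_filter_add_card_filter_not (s := G) (fun B => v ∈ B)
    have h₃ : (#{A ∈ F | v ∈ A} : ℝ) ≤ #{B ∈ G | v ∉ B} := by exact_mod_cast h₁
    have h₄ := rchoose_succ_succ (r + s) r
    have hr : (0 : ℝ) ≤ r + 1 := by positivity
    have h₅ : (r + 1 : ℝ) * #{A ∈ F | v ∈ A} ≤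
        (r + 1) * (rchoose (r + s + 1) (r + 1) - #{B ∈ G | v ∈ B}) :=
      mul_le_mul_of_nonneg_left (by linarith) hr
    have h₆ : (r + s + 1) * rchoose (r + s) r ≤ (r + s + 1) * #{B ∈ G | v ∈ B} :=
      mul_le_mul_of_nonneg_left hd (by positivity)
    linarith
  · cases r with
    | zero =>
      have hG₀ : #{B ∈ G | v ∈ B} = 0 := by
        simpa [rchoose] using hd
      have hF₀ : #{A ∈ F | v ∈ A} = 0 := by
        rw [card_eq_zero, filter_eq_empty_iff] at hG₀ ⊢
        intro A hA hv
        obtain ⟨a, ha, hav⟩ := exists_mem_ne (by rw [hF A hA]; norm_num : 1 < #A) v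
        exact hG₀ (hFG A hA a ha) (mem_erase.2 ⟨hav.symm, hv⟩)
      simp [hG₀, hF₀]
    | succ r =>
      have h := ih r r.lt_succ_self (({A ∈ F | v ∈ A}).image (fun A => A.erase v))
        (({B ∈ G | v ∈ B}).image (fun B => B.erase v)) ?_ ?_ ?_ ?_
      · rw [card_image_erase_filter_mem, card_image_erase_filter_mem] at h
        push_cast
        linarith
      · simp only [mem_image, mem_filter]
        rintro _ ⟨A, ⟨hA, hv⟩, rfl⟩
        rw [card_erase_of_mem hv, hF A hA]
        omega
      · simp only [mem_image, mem_filter]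
        rintro _ ⟨A, ⟨hA, hv⟩, rfl⟩
        rw [card_erase_of_mem hv, hG A hA]
        omega
      · simp only [mem_image, mem_filter]
        rintro _ ⟨A, ⟨hA, hv⟩, rfl⟩ a ha
        rw [mem_erase] at ha
        exact ⟨A.erase a, ⟨hFG A hA a ha.2, mem_erase.2 ⟨ha.1.symm, hv⟩⟩, erase_right_comm⟩
      · rw [card_image_erase_filter_mem]
        have e : ((r + 1 : ℕ) : ℝ) + s = r + s + 1 := by push_cast; ring
        rw [e] at hd
        exact hd.le

open Finset FinsetFamily in
/-- Lovász's version of the Kruskal–Katona theorem, as a bound on the ratio between the size of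
a family and the size of its shadow. -/
theorem mul_card_le_mul_card_shadow {X : Type*} [DecidableEq X] [Fintype X] {s : ℝ} (hs : 0 ≤ s)
    (r : ℕ) (F : Finset (Finset X)) (hF : ∀ A ∈ F, #A = r + 1)
    (hcard : (#F : ℝ) ≤ rchoose (r + s) (r + 1)) :
    (r + 1) * (#F : ℝ) ≤ s * #(∂ F) := by
  rcases le_or_gt (rchoose (r + s) r) (#(∂ F) : ℝ) with hd | hd
  · have h₁ := rchoose_succ_right (r + s) r
    have h₂ : (r + 1 : ℝ) * #F ≤ (r + 1) * rchoose (r + s) (r + 1) :=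
      mul_le_mul_of_nonneg_left hcard (by positivity)
    have h₃ := mul_le_mul_of_nonneg_left hd hs
    rw [add_sub_cancel_left] at h₁
    linarith
  · cases r with
    | zero =>
      have h₀ : #(∂ F) = 0 := by simpa [rchoose] using hd
      have hF₀ : F = ∅ := by
        rw [card_eq_zero] at h₀
        refine eq_empty_of_forall_notMem fun A hA => ?_
        obtain ⟨a, ha⟩ := card_pos.1 (by rw [hF A hA]; norm_num : 0 < #A)
        simpa [h₀] using erase_mem_shadow hA ha
      simp [hF₀]
    | succ r =>
      have e : ((r + 1 : ℕ) : ℝ) + s = r + s + 1 := by push_cast; ring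
      rw [e] at hd
      have h := card_le_of_erase_mem hs r F (∂ F) hF
        (fun B hB => (Set.Sized.shadow (r := r + 2) fun A hA => hF A hA) hB)
        (fun A hA a ha => erase_mem_shadow hA ha) hd.le
      push_cast
      linarith


theorem shadow_weight_lower_bound {X : Type*} [DecidableEq X] [Fintype X] (k : ℕ)
    (w : Finset X → ℝ) (hw : ∀ A, w A ∈ Set.Icc (0 : ℝ) 1)
    (hsupp : ∀ A : Finset X, w A ≠ 0 → A.card = k)
    (hS : ∑ A : Finset X, w A ≤ 1)
    -- ℓ i is the unique nonnegative real with 2^i = C(k - 1 + ℓ i, k)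
    (ℓ : ℕ → ℝ) (hℓ0 : ∀ i, 0 ≤ ℓ i)
    (hℓ : ∀ i : ℕ, (2 : ℝ) ^ i = rchoose ((k : ℝ) - 1 + ℓ i) k)
    -- π_i w
    (piw : ℕ → Finset X → ℝ)
    (hpiw : ∀ i A, piw i A = if (2 : ℝ) ^ (-(i : ℤ)) ≤ w A then (2 : ℝ) ^ (-(i : ℤ) - 1) else 0)
    -- Δ : (Δ u)(B) = max_{a ∉ B} u (B ∪ {a}) for B ≠ X, (Δ u)(X) = 0
    (Δ : (Finset X → ℝ) → (Finset X → ℝ))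
    (hΔuniv : ∀ u : Finset X → ℝ, Δ u Finset.univ = 0)
    (hΔmax : ∀ u : Finset X → ℝ, ∀ B : Finset X, B ≠ Finset.univ →
      (∀ a ∉ B, u (insert a B) ≤ Δ u B) ∧ (∃ a ∉ B, Δ u B = u (insert a B))) :
    ∀ i : ℕ, (∑ A : Finset X, piw i A) * k / ℓ i ≤ ∑ B : Finset X, Δ (piw i) B := by
  intro i
  set c : ℝ := (2 : ℝ) ^ (-(i : ℤ) - 1) with hc
  have hc₀ : 0 < c := by positivity
  set F : Finset (Finset X) := {A | (2 : ℝ) ^ (-(i : ℤ)) ≤ w A} with hFdef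
  have hpow : (0 : ℝ) < 2 ^ (-(i : ℤ)) := by positivity
  have hmem (A : Finset X) : A ∈ F ↔ (2 : ℝ) ^ (-(i : ℤ)) ≤ w A := by simp [hFdef]
  have hpi (A : Finset X) : piw i A = if A ∈ F then c else 0 := by
    rw [hpiw]
    simp only [hmem, hc]
  have hpi₀ (A : Finset X) : 0 ≤ piw i A := by
    rw [hpi]
    split_ifs
    exacts [hc₀.le, le_rfl]
  have hFk (A : Finset X) (hA : A ∈ F) : A.card = k :=
    hsupp A (hpow.trans_le ((hmem A).1 hA)).ne'
  have hFcard : (F.card : ℝ) ≤ 2 ^ i := by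
    have h : (F.card : ℝ) * 2 ^ (-(i : ℤ)) ≤ 1 := by
      calc (F.card : ℝ) * 2 ^ (-(i : ℤ)) = ∑ A ∈ F, (2 : ℝ) ^ (-(i : ℤ)) := by
            rw [Finset.sum_const, nsmul_eq_mul]
        _ ≤ ∑ A ∈ F, w A := Finset.sum_le_sum fun A hA => (hmem A).1 hA
        _ ≤ ∑ A, w A := Finset.sum_le_univ_sum_of_nonneg fun A => (hw A).1
        _ ≤ 1 := hS
    rwa [zpow_neg, zpow_natCast, ← div_eq_mul_inv, div_le_one (by positivity)] at h
  have hsum : ∑ A, piw i A = F.card * c := by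
    simp [hpi, Finset.sum_ite_mem]
  have hΔ₀ (B : Finset X) : 0 ≤ Δ (piw i) B := by
    by_cases hB : B = Finset.univ
    · rw [hB, hΔuniv]
    · obtain ⟨a, -, ha⟩ := (hΔmax (piw i) B hB).2
      rw [ha]
      exact hpi₀ _
  have hΔc (B : Finset X) (hB : B ∈ F.shadow) : c ≤ Δ (piw i) B := by
    obtain ⟨a, ha, haF⟩ := Finset.mem_shadow_iff_insert_mem.1 hB
    have hne : B ≠ Finset.univ := by
      rintro rfl
      exact ha (Finset.mem_univ a)
    simpa [hpi, haF] using (hΔmax (piw i) B hne).1 a ha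
  have hΔsum : F.shadow.card * c ≤ ∑ B, Δ (piw i) B := by
    calc F.shadow.card * c = ∑ B ∈ F.shadow, c := by rw [Finset.sum_const, nsmul_eq_mul]
      _ ≤ ∑ B ∈ F.shadow, Δ (piw i) B := Finset.sum_le_sum hΔc
      _ ≤ _ := Finset.sum_le_univ_sum_of_nonneg hΔ₀
  cases k with
  | zero => simpa using Finset.sum_nonneg fun B _ => hΔ₀ B
  | succ r =>
    have hLov := mul_card_le_mul_card_shadow (hℓ0 i) r F hFk (by
      have h := hℓ i
      rw [Nat.cast_succ, add_sub_cancel_right] at h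
      exact hFcard.trans_eq h)
    refine le_trans (div_le_of_le_mul₀ (hℓ0 i) (by positivity) ?_) hΔsum
    rw [hsum]
    push_cast
    nlinarith [mul_le_mul_of_nonneg_right hLov hc₀.le]
end

section
/- There exists a subset X of S_n of size exactly lcm(1, 2, ..., n) such that the uniform distribution on X is exact minwise: for every nonempty Y ⊆ [n] and x ∈ Y, the fraction of permutations π ∈ X with π(x) = min π(Y) equals 1/|Y|. -/
/-- Numbers of the form `L * k! * d! / (k + d + 1)!` are integers when `1, ..., k + d + 1` all
divide `L`. -/
theorem exists_int_mul_factorial_eq (L : ℕ) (k : ℕ) : ∀ d : ℕ,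
    (∀ j, 1 ≤ j → j ≤ k + d + 1 → j ∣ L) →
    ∃ z : ℤ, z * ((k + d + 1).factorial : ℤ) = L * k.factorial * d.factorial := by
  induction k with
  | zero =>
    intro d h
    obtain ⟨c, hc⟩ := h (d + 1) (by omega) (by omega)
    refine ⟨c, ?_⟩
    rw [hc, Nat.zero_add, Nat.factorial_succ]
    push_cast
    simp
    ring
  | succ k ih =>
    intro d h
    obtain ⟨z₁, h₁⟩ := ih d fun j hj hj' => h j hj (by omega)
    obtain ⟨z₂, h₂⟩ := ih (d + 1) fun j hj hj' => h j hj (by omega)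
    refine ⟨z₁ - z₂, ?_⟩
    have e : k + 1 + d + 1 = (k + d + 1) + 1 := by ring
    have e' : k + (d + 1) + 1 = (k + d + 1) + 1 := by ring
    rw [e'] at h₂
    rw [e, sub_mul, h₂, Nat.factorial_succ (k + d + 1), Nat.factorial_succ k,
      Nat.factorial_succ d]
    push_cast
    linear_combination ((k : ℤ) + d + 1 + 1) * h₁

theorem sub_mul_choose_dvd {n k L : ℕ} (hk : k < n) (h : ∀ j, 1 ≤ j → j ≤ n → j ∣ L) :
    (n - k) * n.choose k ∣ L := by
  obtain ⟨d, rfl⟩ : ∃ d, n = k + d + 1 := ⟨n - k - 1, by omega⟩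
  obtain ⟨z, hz⟩ := exists_int_mul_factorial_eq L k d h
  have e : k + d + 1 - k = d + 1 := by omega
  have hc := Nat.choose_mul_factorial_mul_factorial hk.le
  rw [e, Nat.factorial_succ] at hc
  rw [e, ← Int.natCast_dvd_natCast]
  refine ⟨z, ?_⟩
  have hp : ((k.factorial * d.factorial : ℕ) : ℤ) ≠ 0 := by positivity
  apply mul_right_cancel₀ hp
  rw [← hc] at hz
  push_cast at hz ⊢
  linear_combination -hz

theorem card_Ico_filter_mod_eq (a m M r : ℕ) (hr : r < m) :
    ((Finset.Ico a (a + m * M)).filter (fun j => j % m = r)).card = M := by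
  induction M with
  | zero => simp
  | succ M ih =>
    have hu : Finset.Ico a (a + m * (M + 1)) =
        Finset.Ico a (a + m * M) ∪ Finset.Ico (a + m * M) (a + m * M + m) := by
      rw [Finset.Ico_union_Ico_eq_Ico (by omega) (by omega), Nat.mul_succ, add_assoc]
    have hd : Disjoint (Finset.Ico a (a + m * M))
        (Finset.Ico (a + m * M) (a + m * M + m)) := Finset.Ico_disjoint_Ico_consecutive _ _ _
    rw [hu, Finset.filter_union,
      Finset.card_union_of_disjoint (Finset.disjoint_filter_filter hd), ih,
      Nat.filter_Ico_card_eq_of_periodic _ _ _ (fun j => by simp)]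
    rw [Nat.count_eq_card_filter_range]
    congr 1
    rw [Finset.card_eq_one]
    refine ⟨r, ?_⟩
    ext j
    simp only [Finset.mem_filter, Finset.mem_range, Finset.mem_singleton]
    constructor
    · rintro ⟨h, h'⟩
      rwa [Nat.mod_eq_of_lt h] at h'
    · rintro rfl
      exact ⟨hr, Nat.mod_eq_of_lt hr⟩

/-- A finite set can be enumerated so that the fibres of `h` are intervals. -/
theorem exists_enumeration_fibres_Ico {ι β : Type*} [DecidableEq ι] [DecidableEq β]
    (h : ι → β) (B : Finset β) : ∀ S : Finset ι, (∀ i ∈ S, h i ∈ B) →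
    ∃ e : ι → ℕ, Set.InjOn e S ∧ S.image e = Finset.range S.card ∧
      ∀ b, ∃ a, (S.filter (fun i => h i = b)).image e =
        Finset.Ico a (a + (S.filter (fun i => h i = b)).card) := by
  induction B using Finset.induction_on with
  | empty =>
    intro S hS
    have : S = ∅ := Finset.eq_empty_of_forall_notMem fun i hi => by simpa using hS i hi
    subst this
    exact ⟨fun _ => 0, by simp, by simp, fun b => ⟨0, by simp⟩⟩
  | insert b B hb ih =>
    intro S hS
    obtain ⟨e, he, he', hf⟩ := ih (S.filter (fun i => h i ≠ b)) (by
      intro i hi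
      rw [Finset.mem_filter] at hi
      exact Finset.mem_of_mem_insert_of_ne (hS i hi.1) hi.2)
    set S₀ := S.filter (fun i => h i ≠ b) with hS₀
    set S₁ := S.filter (fun i => h i = b) with hS₁
    have hcard : S₁.card + S₀.card = S.card := Finset.card_filter_add_card_filter_not _
    obtain ⟨g, hg, hg'⟩ : ∃ g : ι → ℕ, Set.InjOn g S₁ ∧
        S₁.image g = Finset.Ico S₀.card (S₀.card + S₁.card) := by
      obtain ⟨g, hg⟩ : ∃ g : ι → ℕ, Set.BijOn g S₁ (Finset.Ico S₀.card (S₀.card + S₁.card)) :=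
        S₁.finite_toSet.exists_bijOn_of_encard_eq (by
          rw [Set.encard_coe_eq_coe_finsetCard, Set.encard_coe_eq_coe_finsetCard,
            Nat.card_Ico, Nat.add_sub_cancel_left])
      refine ⟨g, hg.injOn, ?_⟩
      rw [← Finset.coe_inj, Finset.coe_image]
      exact hg.image_eq
    have hlt : ∀ i ∈ S₀, e i < S₀.card := fun i hi => by
      rw [← Finset.mem_range, ← he']
      exact Finset.mem_image_of_mem e hi
    have hge : ∀ i ∈ S₁, S₀.card ≤ g i := fun i hi => by
      have := Finset.mem_image_of_mem g hi
      rw [hg', Finset.mem_Ico] at this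
      exact this.1
    let f : ι → ℕ := fun i => if h i = b then g i else e i
    have hf₁ : ∀ i ∈ S₁, f i = g i := fun i hi => by
      simp [f, (Finset.mem_filter.1 hi).2]
    have hf₀ : ∀ i ∈ S₀, f i = e i := fun i hi => by
      simp [f, (Finset.mem_filter.1 hi).2]
    have hi₁ : S₁.image f = S₁.image g := Finset.image_congr hf₁
    refine ⟨f, ?_, ?_, ?_⟩
    · intro i hi j hj hij
      by_cases h₁ : h i = b <;> by_cases h₂ : h j = b
      · have hi : i ∈ S₁ := Finset.mem_filter.2 ⟨hi, h₁⟩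
        have hj : j ∈ S₁ := Finset.mem_filter.2 ⟨hj, h₂⟩
        rw [hf₁ i hi, hf₁ j hj] at hij
        exact hg hi hj hij
      · have hi : i ∈ S₁ := Finset.mem_filter.2 ⟨hi, h₁⟩
        have hj : j ∈ S₀ := Finset.mem_filter.2 ⟨hj, h₂⟩
        rw [hf₁ i hi, hf₀ j hj] at hij
        have := hlt j hj
        have := hge i hi
        omega
      · have hi : i ∈ S₀ := Finset.mem_filter.2 ⟨hi, h₁⟩
        have hj : j ∈ S₁ := Finset.mem_filter.2 ⟨hj, h₂⟩
        rw [hf₀ i hi, hf₁ j hj] at hij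
        have := hlt i hi
        have := hge j hj
        omega
      · have hi : i ∈ S₀ := Finset.mem_filter.2 ⟨hi, h₁⟩
        have hj : j ∈ S₀ := Finset.mem_filter.2 ⟨hj, h₂⟩
        rw [hf₀ i hi, hf₀ j hj] at hij
        exact he hi hj hij
    · have hu : S = S₁ ∪ S₀ := (Finset.filter_union_filter_not_eq _ _).symm
      have hi₀ : S₀.image f = S₀.image e := Finset.image_congr hf₀
      rw [← hcard]
      conv_lhs => rw [hu]
      rw [Finset.image_union, hi₀, hi₁, he', hg']
      ext j
      simp only [Finset.mem_union, Finset.mem_range, Finset.mem_Ico]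
      omega
    · intro c
      by_cases hc : c = b
      · subst hc
        exact ⟨S₀.card, by rw [← hS₁, hi₁, hg']⟩
      · obtain ⟨a, ha⟩ := hf c
        have hS' : S₀.filter (fun i => h i = c) = S.filter (fun i => h i = c) := by
          ext i
          simp only [hS₀, Finset.mem_filter]
          constructor
          · rintro ⟨⟨h₁, -⟩, h₂⟩
            exact ⟨h₁, h₂⟩
          · rintro ⟨h₁, rfl⟩
            exact ⟨⟨h₁, hc⟩, rfl⟩
        refine ⟨a, ?_⟩
        rw [← hS', ← ha]
        exact Finset.image_congr fun i hi => hf₀ i (Finset.mem_filter.1 hi).1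

/-- An equidistributed colouring of `S` by `T` that also spreads every fibre of `h` evenly. -/
theorem exists_balanced_colouring {ι α β : Type*} [DecidableEq ι] [DecidableEq α]
    [DecidableEq β] [Nonempty α] (S : Finset ι) (h : ι → β) (T : Finset α) (q : ℕ)
    (hT : T.Nonempty) (hST : S.card = T.card * q) :
    ∃ x : ι → α, (∀ i, x i ∈ T) ∧ (∀ t ∈ T, (S.filter (fun i => x i = t)).card = q) ∧
      ∀ b, ∀ t ∈ T, ∀ M, (S.filter (fun i => h i = b)).card ≤ T.card * M →
        (S.filter (fun i => h i = b ∧ x i = t)).card ≤ M := by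
  obtain ⟨e, he, he', hf⟩ := exists_enumeration_fibres_Ico h (S.image h) S
    fun i hi => Finset.mem_image_of_mem h hi
  have hm : 0 < T.card := hT.card_pos
  let x : ι → α := fun i => (T.equivFin.symm ⟨e i % T.card, Nat.mod_lt _ hm⟩ : T)
  have hx : ∀ t (ht : t ∈ T) i, x i = t ↔ e i % T.card = (T.equivFin ⟨t, ht⟩ : ℕ) := by
    intro t ht i
    have : x i = t ↔ T.equivFin.symm ⟨e i % T.card, Nat.mod_lt _ hm⟩ = ⟨t, ht⟩ := by
      rw [Subtype.ext_iff]
    rw [this, Equiv.symm_apply_eq, Fin.ext_iff]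
  have key : ∀ (S' : Finset ι), S' ⊆ S → ∀ t (ht : t ∈ T),
      (S'.filter (fun i => x i = t)).card =
        ((S'.image e).filter (fun j => j % T.card = (T.equivFin ⟨t, ht⟩ : ℕ))).card := by
    intro S' hS' t ht
    rw [Finset.filter_image, Finset.card_image_of_injOn]
    · simp only [hx t ht]
    · exact he.mono fun i hi => hS' (Finset.mem_filter.1 hi).1
  refine ⟨x, fun i => Subtype.prop _, ?_, ?_⟩
  · intro t ht
    rw [key S subset_rfl t ht, he', hST, Finset.range_eq_Ico]
    simpa using card_Ico_filter_mod_eq 0 T.card q _ (T.equivFin ⟨t, ht⟩).2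
  · intro b t ht M hM
    obtain ⟨a, ha⟩ := hf b
    rw [← Finset.filter_filter, key _ (Finset.filter_subset _ _) t ht, ha]
    refine le_trans (Finset.card_le_card ?_)
      (card_Ico_filter_mod_eq a T.card M _ (T.equivFin ⟨t, ht⟩).2).le
    exact Finset.filter_subset_filter _ (Finset.Ico_subset_Ico le_rfl (by omega))

/-- The first `k` entries of the sequences `σ i`, `i : ι`, are distinct, their prefixes are
equidistributed over the sets of each size and over their one-point extensions, and no prefix of
length `k` is repeated more than necessary. -/
structure IsBalancedPrefix {ι : Type*} [Fintype ι] (n k : ℕ) (σ : ι → ℕ → Fin n) : Prop where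
  injOn : ∀ i, Set.InjOn (σ i) (Finset.range k)
  card_set : ∀ A : Finset (Fin n), A.card = k →
    (Finset.univ.filter (fun i => (Finset.range k).image (σ i) = A)).card * n.choose k =
      Fintype.card ι
  card_edge : ∀ A : Finset (Fin n), A.card < k → ∀ x ∉ A,
    (Finset.univ.filter
      (fun i => (Finset.range A.card).image (σ i) = A ∧ σ i A.card = x)).card *
        ((n - A.card) * n.choose A.card) = Fintype.card ι
  card_prefix : ∀ i M, Fintype.card ι ≤ n.descFactorial k * M →
    (Finset.univ.filter (fun i' => ∀ j < k, σ i' j = σ i j)).card ≤ M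

theorem IsBalancedPrefix.exists_succ {ι : Type*} [Fintype ι] {n k : ℕ}
    {σ : ι → ℕ → Fin n} (hσ : IsBalancedPrefix n k σ) (hk : k < n)
    (hdvd : (n - k) * n.choose k ∣ Fintype.card ι) :
    ∃ τ : ι → ℕ → Fin n, IsBalancedPrefix n (k + 1) τ := by
  classical
  obtain ⟨c, hc⟩ := hdvd
  have : Nonempty (Fin n) := ⟨⟨k, hk⟩⟩
  have hch : 0 < n.choose k := Nat.choose_pos hk.le
  let P : ι → Finset (Fin n) := fun i => (Finset.range k).image (σ i)
  have hP : ∀ i, (P i).card = k := fun i => by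
    rw [Finset.card_image_of_injOn (hσ.injOn i), Finset.card_range]
  have hcompl : ∀ A : Finset (Fin n), A.card = k → Aᶜ.card = n - k := fun A hA => by
    rw [Finset.card_compl, Fintype.card_fin, hA]
  have hex : ∀ A : Finset (Fin n), ∃ x : ι → Fin n, A.card = k →
      (∀ i, x i ∈ Aᶜ) ∧
      (∀ t ∈ Aᶜ, ((Finset.univ.filter (fun i => P i = A)).filter (fun i => x i = t)).card = c) ∧
      ∀ b, ∀ t ∈ Aᶜ, ∀ M, ((Finset.univ.filter (fun i => P i = A)).filter
          (fun i => (fun j : Fin k => σ i j) = b)).card ≤ Aᶜ.card * M →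
        ((Finset.univ.filter (fun i => P i = A)).filter
          (fun i => (fun j : Fin k => σ i j) = b ∧ x i = t)).card ≤ M := by
    intro A
    by_cases hA : A.card = k
    · obtain ⟨x, hx⟩ := exists_balanced_colouring (Finset.univ.filter (fun i => P i = A))
        (fun i => fun j : Fin k => σ i j) Aᶜ c
        (by rw [← Finset.card_pos, hcompl A hA]; omega)
        (by
          apply Nat.eq_of_mul_eq_mul_right hch
          rw [hσ.card_set A hA, hc, hcompl A hA]
          ring)
      exact ⟨x, fun _ => hx⟩
    · exact ⟨fun _ => ⟨k, hk⟩, fun h => absurd h hA⟩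
  choose x hx using hex
  let τ : ι → ℕ → Fin n := fun i => Function.update (σ i) k (x (P i) i)
  have hτk : ∀ i, τ i k = x (P i) i := fun i => by simp [τ]
  have hτ : ∀ i, ∀ j < k, τ i j = σ i j := fun i j hj => by
    simp [τ, Function.update_of_ne hj.ne]
  have himg : ∀ i, ∀ m ≤ k, (Finset.range m).image (τ i) = (Finset.range m).image (σ i) :=
    fun i m hm => Finset.image_congr fun j hj =>
      hτ i j (lt_of_lt_of_le (Finset.mem_range.1 hj) hm)
  have hnot : ∀ i, τ i k ∉ P i := fun i => by
    rw [hτk, ← Finset.mem_compl]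
    exact (hx (P i) (hP i)).1 i
  have himgs : ∀ i, (Finset.range (k + 1)).image (τ i) = insert (τ i k) (P i) := fun i => by
    rw [Finset.range_add_one, Finset.image_insert, himg i k le_rfl]
  have hedge : ∀ A : Finset (Fin n), A.card = k → ∀ t ∉ A,
      (Finset.univ.filter (fun i => P i = A ∧ τ i k = t)).card = c := by
    intro A hA t ht
    rw [← (hx A hA).2.1 t (Finset.mem_compl.2 ht), Finset.filter_filter]
    congr 1
    ext i
    simp only [Finset.mem_filter, Finset.mem_univ, true_and, hτk]
    constructor <;> (rintro ⟨rfl, h⟩; exact ⟨rfl, h⟩)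
  refine ⟨τ, ?_, ?_, ?_, ?_⟩
  · intro i
    apply Finset.injOn_of_card_image_eq
    rw [himgs, Finset.card_insert_of_notMem (hnot i), hP, Finset.card_range]
  · intro A hA
    have hsum : (Finset.univ.filter
        (fun i => (Finset.range (k + 1)).image (τ i) = A)).card = (k + 1) * c := by
      rw [Finset.card_eq_sum_card_fiberwise (f := fun i => τ i k) (t := A)]
      · rw [show (k + 1) * c = A.card • c by rw [hA, smul_eq_mul]]
        apply Finset.sum_eq_card_nsmul
        intro t ht
        rw [← hedge (A.erase t) (by rw [Finset.card_erase_of_mem ht, hA]; rfl) t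
          (Finset.notMem_erase t A), Finset.filter_filter]
        congr 1
        ext i
        simp only [Finset.mem_filter, Finset.mem_univ, true_and, himgs]
        constructor
        · rintro ⟨rfl, rfl⟩
          exact ⟨(Finset.erase_insert (hnot i)).symm, rfl⟩
        · rintro ⟨h, rfl⟩
          exact ⟨by rw [h, Finset.insert_erase ht], rfl⟩
      · intro i hi
        have hi' := (Finset.mem_filter.1 hi).2
        rw [himgs] at hi'
        change τ i k ∈ A
        rw [← hi']
        exact Finset.mem_insert_self _ _
    rw [hsum, hc]
    linear_combination c * Nat.choose_succ_right_eq n k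
  · intro A hA t ht
    rcases Nat.lt_succ_iff_lt_or_eq.1 hA with h | h
    · rw [← hσ.card_edge A h t ht]
      simp only [himg _ _ h.le, hτ _ _ h]
    · rw [h]
      simp only [himg _ _ le_rfl]
      rw [hedge A h t ht, hc, mul_comm]
  · intro i M hM
    have h₁ := hσ.card_prefix i ((n - k) * M)
      (by rw [Nat.descFactorial_succ] at hM; linarith)
    have h₂ := (hx (P i) (hP i)).2.2 (fun j : Fin k => σ i j) (τ i k)
      (Finset.mem_compl.2 (hnot i)) M (by
        rw [hcompl _ (hP i)]
        refine le_trans (Finset.card_le_card ?_) h₁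
        intro i' hi'
        simp only [Finset.mem_filter, Finset.mem_univ, true_and] at hi' ⊢
        exact fun j hj => congrFun hi'.2 ⟨j, hj⟩)
    refine le_trans (Finset.card_le_card ?_) h₂
    intro i' hi'
    simp only [Finset.mem_filter, Finset.mem_univ, true_and] at hi' ⊢
    have hag : ∀ j < k, σ i' j = σ i j := fun j hj => by
      rw [← hτ i' j hj, ← hτ i j hj]
      exact hi' j (by omega)
    have hPP : P i' = P i := Finset.image_congr fun j hj => hag j (Finset.mem_range.1 hj)
    refine ⟨hPP, funext fun j => hag j j.2, ?_⟩
    rw [← hPP, ← hτk, hi' k (by omega)]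

theorem exists_isBalancedPrefix {ι : Type*} [Fintype ι] (n : ℕ) (hn : 0 < n)
    (h : ∀ j, 1 ≤ j → j ≤ n → j ∣ Fintype.card ι) :
    ∀ k ≤ n, ∃ σ : ι → ℕ → Fin n, IsBalancedPrefix n k σ := by
  intro k
  induction k with
  | zero =>
    intro _
    refine ⟨fun _ _ => ⟨0, hn⟩, by simp, ?_, by simp, ?_⟩
    · intro A hA
      rw [Finset.card_eq_zero] at hA
      simp [hA]
    · intro i M hM
      simpa using hM
  | succ k ih =>
    intro hk
    obtain ⟨σ, hσ⟩ := ih (by omega)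
    exact hσ.exists_succ hk (sub_mul_choose_dvd hk h)

theorem exists_optimal_minwise_family (n : ℕ) :
    ∃ X : Finset (Equiv.Perm (Fin n)),
      X.card = (Finset.Icc 1 n).lcm id ∧
      ∀ Y : Finset (Fin n), Y.Nonempty → ∀ x ∈ Y,
        ((X.filter (fun π => ∀ y ∈ Y, π x ≤ π y)).card : ℝ) / (X.card : ℝ)
          = 1 / (Y.card : ℝ) := by
  classical
  rcases Nat.eq_zero_or_pos n with rfl | hn
  · exact ⟨{1}, by simp, fun Y _ x => x.elim0⟩
  set L := (Finset.Icc 1 n).lcm id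
  have hdvd : ∀ j, 1 ≤ j → j ≤ n → j ∣ L := fun j h₁ h₂ =>
    Finset.dvd_lcm (f := id) (Finset.mem_Icc.2 ⟨h₁, h₂⟩)
  have hLn : L ∣ n.factorial := Finset.lcm_dvd fun j hj =>
    Nat.dvd_factorial (Finset.mem_Icc.1 hj).1 (Finset.mem_Icc.1 hj).2
  have hLpos : 0 < L := Nat.pos_of_dvd_of_pos hLn n.factorial_pos
  obtain ⟨σ, hσ⟩ := exists_isBalancedPrefix (ι := Fin L) n hn (by simpa using hdvd) n le_rfl
  have hinj : ∀ i, Function.Injective (fun j : Fin n => σ i j) := fun i j j' hjj =>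
    Fin.ext (hσ.injOn i (by simp) (by simp) hjj)
  let s : Fin L → Equiv.Perm (Fin n) := fun i =>
    Equiv.ofBijective _ (Finite.injective_iff_bijective.1 (hinj i))
  have hs : ∀ i j, s i j = σ i j := fun i j => rfl
  let p : Fin L → Equiv.Perm (Fin n) := fun i => (s i).symm
  have hp : Function.Injective p := by
    intro i i' h
    have h' : s i = s i' := Equiv.symm_bijective.injective h
    have hcard := hσ.card_prefix i 1 (by
      rw [Nat.descFactorial_self, Fintype.card_fin, mul_one]
      exact Nat.le_of_dvd n.factorial_pos hLn)
    refine Finset.card_le_one.1 hcard i (by simp) i' ?_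
    simp only [Finset.mem_filter, Finset.mem_univ, true_and]
    intro j hj
    rw [← hs i ⟨j, hj⟩, ← hs i' ⟨j, hj⟩, h']
  have hX : (Finset.univ.image p).card = L := by
    rw [Finset.card_image_of_injective _ hp, Finset.card_univ, Fintype.card_fin]
  refine ⟨Finset.univ.image p, hX, ?_⟩
  intro Y hY x hx
  rw [hX]
  let F : Fin n → Finset (Fin L) := fun x =>
    Finset.univ.filter (fun i => ∀ y ∈ Y, p i x ≤ p i y)
  have hF : ((Finset.univ.image p).filter (fun π => ∀ y ∈ Y, π x ≤ π y)).card =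
      (F x).card := by
    rw [Finset.filter_image, Finset.card_image_of_injective _ hp]
  let Q : Fin n → Fin L → Finset (Fin n) := fun x i => (Finset.range (p i x)).image (σ i)
  have hmemQ : ∀ x i y, y ∈ Q x i ↔ p i y < p i x := by
    intro x i y
    simp only [Q, Finset.mem_image, Finset.mem_range]
    constructor
    · rintro ⟨j, hj, rfl⟩
      have hjn : j < n := hj.trans (p i x).2
      have : p i (σ i j) = ⟨j, hjn⟩ := (s i).symm_apply_apply ⟨j, hjn⟩
      rw [this]
      exact hj
    · intro h
      exact ⟨p i y, h, (s i).apply_symm_apply y⟩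
  have hQcard : ∀ x i, (Q x i).card = p i x := by
    intro x i
    rw [Finset.card_image_of_injOn, Finset.card_range]
    refine (hσ.injOn i).mono ?_
    simp only [Finset.coe_range]
    exact Set.Iio_subset_Iio (p i x).2.le
  have hfib : ∀ x ∈ Y, ∀ A ∈ Yᶜ.powerset,
      ((F x).filter (fun i => Q x i = A)).card * ((n - A.card) * n.choose A.card) = L := by
    intro x hx A hA
    rw [Finset.mem_powerset] at hA
    have hxA : x ∉ A := fun h => Finset.mem_compl.1 (hA h) hx
    have hAn : A.card < n := by
      have := Finset.card_lt_univ_of_notMem hxA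
      simpa using this
    have he := hσ.card_edge A hAn x hxA
    rw [Fintype.card_fin] at he
    refine Eq.trans ?_ he
    congr 2
    ext i
    simp only [F, Finset.mem_filter, Finset.mem_univ, true_and]
    constructor
    · rintro ⟨-, rfl⟩
      rw [hQcard]
      exact ⟨rfl, (s i).apply_symm_apply x⟩
    · rintro ⟨h₁, h₂⟩
      have hpx : p i x = ⟨A.card, hAn⟩ := by
        rw [← h₂]
        exact (s i).symm_apply_apply ⟨A.card, hAn⟩
      have hQA : Q x i = A := by
        change (Finset.range (p i x)).image (σ i) = A
        rw [hpx]
        exact h₁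
      refine ⟨fun y hy => ?_, hQA⟩
      by_contra hlt
      rw [not_le, ← hmemQ, hQA] at hlt
      exact Finset.mem_compl.1 (hA hlt) hy
  have hFsum : ∀ x, (F x).card =
      ∑ A ∈ Yᶜ.powerset, ((F x).filter (fun i => Q x i = A)).card := by
    intro x
    apply Finset.card_eq_sum_card_fiberwise
    intro i hi
    rw [Finset.mem_coe, Finset.mem_powerset]
    intro y hy
    rw [hmemQ] at hy
    rw [Finset.mem_compl]
    intro hyY
    exact absurd ((Finset.mem_filter.1 hi).2 y hyY) (not_le.2 hy)
  have hFeq : ∀ y ∈ Y, (F y).card = (F x).card := by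
    intro y hy
    rw [hFsum x, hFsum y]
    refine Finset.sum_congr rfl fun A hA => ?_
    have h₁ := hfib x hx A hA
    have h₂ := hfib y hy A hA
    exact Nat.eq_of_mul_eq_mul_right
      (Nat.pos_of_ne_zero fun h => by rw [h] at h₁; omega) (h₂.trans h₁.symm)
  have hunion : Y.biUnion F = Finset.univ := by
    ext i
    simp only [F, Finset.mem_biUnion, Finset.mem_filter, Finset.mem_univ, true_and, iff_true]
    exact Finset.exists_min_image Y (p i) hY
  have hdisj : (Y : Set (Fin n)).PairwiseDisjoint F := by
    intro y hy z hz hyz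
    rw [Function.onFun, Finset.disjoint_left]
    intro i hi hi'
    exact hyz ((p i).injective
      (le_antisymm ((Finset.mem_filter.1 hi).2 z hz) ((Finset.mem_filter.1 hi').2 y hy)))
  have htotal : Y.card * (F x).card = L := by
    rw [← smul_eq_mul, ← Finset.sum_eq_card_nsmul hFeq, ← Finset.card_biUnion hdisj, hunion,
      Finset.card_univ, Fintype.card_fin]
  have hYpos : (Y.card : ℝ) ≠ 0 := by exact_mod_cast hY.card_pos.ne'
  have hLne : (L : ℝ) ≠ 0 := by exact_mod_cast hLpos.ne'
  rw [hF, div_eq_div_iff hLne hYpos, one_mul, mul_comm]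
  exact_mod_cast htotal
end
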